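/- For every integer p ≥ 1, the weak version GTs_1 of the Gelfand–Tsetlin variety for the restricted Yangian Y_p(gl_3) is equidimensional of dimension 3p, i.e., every irreducible component of GTs_1 has Krull dimension 3p. -/

import Mathlib

open scoped Classical

noncomputable section



/-- The Zariski topology on affine space `σ → k`: generated by complements of
hypersurfaces. -/
def zariskiTopology (k : Type*) [CommRing k] (σ : Type*) : TopologicalSpace (σ → k) :=
  TopologicalSpace.generateFrom
    {U | ∃ f : MvPolynomial σ k, U = {x | MvPolynomial.eval x f ≠ 0}}

/-- The irreducible components of a subset `V` of affine space, with respect to the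
subspace topology induced by the Zariski topology. -/
def zComponents (k : Type*) [CommRing k] (σ : Type*) (V : Set (σ → k)) : Set (Set V) :=
  @irreducibleComponents V (TopologicalSpace.induced Subtype.val (zariskiTopology k σ))

/-- The topological Krull dimension of a subset `C` of a subset `V` of affine space
(with the topology induced from the Zariski topology). -/
def zKrullDimSub (k : Type*) [CommRing k] (σ : Type*) {V : Set (σ → k)} (C : Set V) :
    WithBot ℕ∞ :=
  @topologicalKrullDim C (TopologicalSpace.induced Subtype.val
    (TopologicalSpace.induced Subtype.val (zariskiTopology k σ)))

/-- The topological Krull dimension of a subset of affine space with the Zariski topology. -/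
def zKrullDim (k : Type*) [CommRing k] (σ : Type*) (V : Set (σ → k)) : WithBot ℕ∞ :=
  @topologicalKrullDim V (TopologicalSpace.induced Subtype.val (zariskiTopology k σ))

/-- Irreducibility of a subset of affine space with the Zariski topology. -/
def zIsIrreducible (k : Type*) [CommRing k] (σ : Type*) (V : Set (σ → k)) : Prop :=
  @IsIrreducible _ (zariskiTopology k σ) V

/-- A subset of affine space is equidimensional of dimension `d` if each of its
irreducible components (w.r.t. the Zariski topology) has Krull dimension `d`. -/
def IsEquidimOfDim (k : Type*) [CommRing k] (σ : Type*) (V : Set (σ → k)) (d : ℕ) : Prop :=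
  ∀ C ∈ zComponents k σ V, zKrullDimSub k σ C = (d : WithBot ℕ∞)




/-- The `m × m` matrix `X(u)_m` over `k[u]` attached to a point `x` of `k^{n²p}`:
its `(a,b)` entry is `δ_{ab} u^p + Σ_{t=1}^p x_{ab}^{(t)} u^{p-t}`. -/
def Xu (k : Type*) [CommRing k] (n p : ℕ) (x : Fin n × Fin n × Fin p → k)
    (m : ℕ) (hm : m ≤ n) : Matrix (Fin m) (Fin m) (Polynomial k) :=
  Matrix.of fun a b =>
    (if (a : ℕ) = (b : ℕ) then Polynomial.X ^ p else 0) +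
      ∑ t : Fin p, Polynomial.C (x (Fin.castLE hm a, Fin.castLE hm b, t)) *
        Polynomial.X ^ (p - ((t : ℕ) + 1))

/-- The value at the point `x` of the polynomial `d̄_{mj}`, defined as the coefficient of
`u^{mp-j}` in `det X(u)_m`. -/
def dbar (k : Type*) [CommRing k] (n p : ℕ) (x : Fin n × Fin n × Fin p → k) (m j : ℕ) : k :=
  if hm : m ≤ n then ((Xu k n p x m hm).det).coeff (m * p - j) else 0

/-- The Gelfand–Tsetlin variety for the restricted Yangian `Y_p(gl_n)`: the common zero
set in `k^{n²p}` of all the polynomials `d̄_{mj}` (`1 ≤ m ≤ n`, `1 ≤ j ≤ mp`). -/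
def GTsYang (k : Type*) [CommRing k] (n p : ℕ) : Set (Fin n × Fin n × Fin p → k) :=
  {x | ∀ m j : ℕ, 1 ≤ m → m ≤ n → 1 ≤ j → j ≤ m * p → dbar k n p x m j = 0}




/-- Accessor for the coordinate `X_{ab}^{(t)}` of a point of `k^{n²p}`, with `1`-based
indices `a, b ∈ {1, …, n}` and `t ∈ {1, …, p}` (and value `0` out of range). -/
def xvn (k : Type*) [CommRing k] (n p : ℕ) (x : Fin n × Fin n × Fin p → k) (a b t : ℕ) : k :=
  if h : 1 ≤ a ∧ a ≤ n ∧ 1 ≤ b ∧ b ≤ n ∧ 1 ≤ t ∧ t ≤ p then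
    x (⟨a - 1, by omega⟩, ⟨b - 1, by omega⟩, ⟨t - 1, by omega⟩) else 0

/-- The value of the polynomial `p_{1i} = X_{11}^{(i)}`. -/
def P1v (k : Type*) [CommRing k] (n p : ℕ) (x : Fin n × Fin n × Fin p → k) (i : ℕ) : k :=
  xvn k n p x 1 1 i

/-- The value of the polynomial `p_{2i}` (for `1 ≤ i ≤ 2p`). -/
def P2v (k : Type*) [CommRing k] (n p : ℕ) (x : Fin n × Fin n × Fin p → k) (i : ℕ) : k :=
  if i ≤ p then
    xvn k n p x 2 2 i - ∑ t ∈ Finset.Icc 1 (i - 1), xvn k n p x 1 2 t * xvn k n p x 2 1 (i - t)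
  else
    ∑ t ∈ Finset.Icc (i - p) p, xvn k n p x 1 2 t * xvn k n p x 2 1 (i - t)

/-- The value of
`T(r,s,m) = −X_{13}^{(r)}X_{22}^{(s)}X_{31}^{(m)} + X_{12}^{(r)}X_{23}^{(s)}X_{31}^{(m)}
 + X_{13}^{(r)}X_{21}^{(s)}X_{32}^{(m)}`. -/
def Tv (k : Type*) [CommRing k] (n p : ℕ) (x : Fin n × Fin n × Fin p → k) (r s m : ℕ) : k :=
  -(xvn k n p x 1 3 r * xvn k n p x 2 2 s * xvn k n p x 3 1 m) +
    xvn k n p x 1 2 r * xvn k n p x 2 3 s * xvn k n p x 3 1 m +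
    xvn k n p x 1 3 r * xvn k n p x 2 1 s * xvn k n p x 3 2 m

/-- The value of the polynomial `p_{3i}` (for `1 ≤ i ≤ 3p`). -/
def P3v (k : Type*) [CommRing k] (n p : ℕ) (x : Fin n × Fin n × Fin p → k) (i : ℕ) : k :=
  if i ≤ p then
    xvn k n p x 3 3 i
      - ∑ s ∈ Finset.Icc 1 (i - 1),
          (xvn k n p x 1 3 s * xvn k n p x 3 1 (i - s) +
           xvn k n p x 2 3 s * xvn k n p x 3 2 (i - s))
      - ∑ r ∈ Finset.Icc 1 (i - 2), ∑ s ∈ Finset.Icc 2 (i - r - 1),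
          xvn k n p x 1 3 r * xvn k n p x 2 2 s * xvn k n p x 3 1 (i - r - s)
      + ∑ r ∈ Finset.Icc 1 (i - 2), ∑ s ∈ Finset.Icc 1 (i - r - 1),
          (xvn k n p x 1 2 r * xvn k n p x 2 3 s * xvn k n p x 3 1 (i - r - s) +
           xvn k n p x 1 3 r * xvn k n p x 2 1 s * xvn k n p x 3 2 (i - r - s))
  else if i = p + 1 then
    - ∑ s ∈ Finset.Icc 1 p,
          (xvn k n p x 1 3 s * xvn k n p x 3 1 (p + 1 - s) +
           xvn k n p x 2 3 s * xvn k n p x 3 2 (p + 1 - s))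
      - ∑ r ∈ Finset.Icc 1 (p - 1), ∑ s ∈ Finset.Icc 2 (p - r),
          xvn k n p x 1 3 r * xvn k n p x 2 2 s * xvn k n p x 3 1 (p + 1 - r - s)
      + ∑ r ∈ Finset.Icc 1 (p - 1), ∑ s ∈ Finset.Icc 1 (p - r),
          (xvn k n p x 1 2 r * xvn k n p x 2 3 s * xvn k n p x 3 1 (p + 1 - r - s) +
           xvn k n p x 1 3 r * xvn k n p x 2 1 s * xvn k n p x 3 2 (p + 1 - r - s))
  else if i ≤ 2 * p then
    - ∑ s ∈ Finset.Icc (i - p) p,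
          (xvn k n p x 1 3 s * xvn k n p x 3 1 (i - s) +
           xvn k n p x 2 3 s * xvn k n p x 3 2 (i - s))
      + ∑ r ∈ Finset.Icc 1 (i - p - 1), ∑ s ∈ Finset.Icc (i - p - r) p,
          Tv k n p x r s (i - r - s)
      + ∑ r ∈ Finset.Icc (i - p) p, ∑ s ∈ Finset.Icc 1 (i - r - 1),
          Tv k n p x r s (i - r - s)
  else
    ∑ r ∈ Finset.Icc (i - 2 * p) p, ∑ s ∈ Finset.Icc (i - p - r) p,
      Tv k n p x r s (i - r - s)


/-- Condition `W`: all the variables `X₁₁^{(t)}, X₁₂^{(t)}, X₂₂^{(t)}` (`1 ≤ t ≤ p`)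
vanish at `x`. -/
def WZero (k : Type*) [CommRing k] (n p : ℕ) (x : Fin n × Fin n × Fin p → k) : Prop :=
  ∀ t : ℕ, 1 ≤ t → t ≤ p →
    xvn k n p x 1 1 t = 0 ∧ xvn k n p x 1 2 t = 0 ∧ xvn k n p x 2 2 t = 0

/-- Condition `D`: all the polynomials `p_{mj} = d̄_{mj}` (`4 ≤ m ≤ n`, `1 ≤ j ≤ mp`)
vanish at `x` (vacuous when `n = 3`). -/
def DZero (k : Type*) [CommRing k] (n p : ℕ) (x : Fin n × Fin n × Fin p → k) : Prop :=
  ∀ m j : ℕ, 4 ≤ m → m ≤ n → 1 ≤ j → j ≤ m * p → dbar k n p x m j = 0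

/-- Condition: `p_{3j}` vanishes at `x` for all `1 ≤ j ≤ J`. -/
def P3Zero (k : Type*) [CommRing k] (n p : ℕ) (x : Fin n × Fin n × Fin p → k) (J : ℕ) : Prop :=
  ∀ j : ℕ, 1 ≤ j → j ≤ J → P3v k n p x j = 0

/-- `GTs₁ = Z(W ∪ {p_{3j} : 1 ≤ j ≤ 3p} ∪ D)`. -/
def GTs1 (k : Type*) [CommRing k] (n p : ℕ) : Set (Fin n × Fin n × Fin p → k) :=
  {x | WZero k n p x ∧ P3Zero k n p x (3 * p) ∧ DZero k n p x}

/-- `W^p = Z(W ∪ {p_{3j} : 1 ≤ j ≤ 3p−3} ∪ {X₃₂^{(p)}, X₂₁^{(p)}, X₁₃^{(p)}} ∪ D)`. -/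
def Wtop (k : Type*) [CommRing k] (n p : ℕ) : Set (Fin n × Fin n × Fin p → k) :=
  {x | WZero k n p x ∧ P3Zero k n p x (3 * p - 3) ∧
       xvn k n p x 3 2 p = 0 ∧ xvn k n p x 2 1 p = 0 ∧ xvn k n p x 1 3 p = 0 ∧ DZero k n p x}

/-- `W_{1s}` (`1 ≤ s ≤ p+1`): the zero set of `W`, `{p_{3j} : 1 ≤ j ≤ 2p}`,
`X₁₃^{(t)}` for `s ≤ t ≤ p`, `X₂₁^{(t)}` for `p−s+2 ≤ t ≤ p`, and `D`.
(For `s = 1` the `X₂₁` conditions are vacuous; for `s = p+1` the `X₁₃` conditions are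
vacuous.) -/
def W1s (k : Type*) [CommRing k] (n p s : ℕ) : Set (Fin n × Fin n × Fin p → k) :=
  {x | WZero k n p x ∧ P3Zero k n p x (2 * p) ∧
       (∀ t : ℕ, s ≤ t → t ≤ p → xvn k n p x 1 3 t = 0) ∧
       (∀ t : ℕ, p + 2 - s ≤ t → t ≤ p → xvn k n p x 2 1 t = 0) ∧ DZero k n p x}

/-- `W₁ = ⋃_{s=1}^{p+1} W_{1s}`. -/
def W1 (k : Type*) [CommRing k] (n p : ℕ) : Set (Fin n × Fin n × Fin p → k) :=
  ⋃ s ∈ Set.Icc 1 (p + 1), W1s k n p s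

/-- `W_{2s}` (`2 ≤ s ≤ p+1`): the zero set of `W`, `{p_{3j} : 1 ≤ j ≤ 2p}`,
`X₂₁^{(t)}` for `s ≤ t ≤ p`, `X₃₂^{(t)}` for `p−s+2 ≤ t ≤ p`, and `D`.
(For `s = p+1` the `X₂₁` conditions are vacuous.) -/
def W2s (k : Type*) [CommRing k] (n p s : ℕ) : Set (Fin n × Fin n × Fin p → k) :=
  {x | WZero k n p x ∧ P3Zero k n p x (2 * p) ∧
       (∀ t : ℕ, s ≤ t → t ≤ p → xvn k n p x 2 1 t = 0) ∧
       (∀ t : ℕ, p + 2 - s ≤ t → t ≤ p → xvn k n p x 3 2 t = 0) ∧ DZero k n p x}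

/-- `W₂ = ⋃_{s=2}^{p+1} W_{2s}`. -/
def W2 (k : Type*) [CommRing k] (n p : ℕ) : Set (Fin n × Fin n × Fin p → k) :=
  ⋃ s ∈ Set.Icc 2 (p + 1), W2s k n p s

/-- `W_{3s}` (`2 ≤ s ≤ p`): the zero set of `W`, `{p_{3j} : 1 ≤ j ≤ 2p}`,
`X₁₃^{(t)}` for `s ≤ t ≤ p`, `X₃₂^{(t)}` for `p−s+2 ≤ t ≤ p`, and `D`. -/
def W3s (k : Type*) [CommRing k] (n p s : ℕ) : Set (Fin n × Fin n × Fin p → k) :=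
  {x | WZero k n p x ∧ P3Zero k n p x (2 * p) ∧
       (∀ t : ℕ, s ≤ t → t ≤ p → xvn k n p x 1 3 t = 0) ∧
       (∀ t : ℕ, p + 2 - s ≤ t → t ≤ p → xvn k n p x 3 2 t = 0) ∧ DZero k n p x}

/-- `W₃ = ⋃_{s=2}^{p} W_{3s}`. -/
def W3 (k : Type*) [CommRing k] (n p : ℕ) : Set (Fin n × Fin n × Fin p → k) :=
  ⋃ s ∈ Set.Icc 2 p, W3s k n p s

open Polynomial in
lemma gt_key {K : Type*} [Field K] (p : ℕ) (A B C D E F : K[X])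
    (hA : A.natDegree ≤ p) (hB : B.natDegree ≤ p) (hC : C.natDegree ≤ p)
    (hD : D.natDegree ≤ p) (hE : E.natDegree ≤ p) (hF : F.natDegree ≤ p)
    (A0 : A.coeff 0 = 0) (B0 : B.coeff 0 = 0) (C0 : C.coeff 0 = 0)
    (D0 : D.coeff 0 = 0) (E0 : E.coeff 0 = 0)
    (heq : F + A * B * C = A * E + D * C) (hle : C.natDegree ≤ A.natDegree) :
    ∃ S : Finset K, S.card ≤ 3 * p ∧ ∀ L : Subfield K, (↑S ⊆ (L : Set K)) →
      ∀ t, A.coeff t ∈ L ∧ B.coeff t ∈ L ∧ C.coeff t ∈ L ∧ D.coeff t ∈ L ∧ E.coeff t ∈ L ∧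
        F.coeff t ∈ L := by
  classical
  have hbc : B.natDegree + C.natDegree ≤ p := by
    by_contra hcon
    have hb : 0 < B.natDegree := by omega
    have hc : 0 < C.natDegree := by omega
    have hB' : B ≠ 0 := by rintro rfl; simp at hb
    have hC' : C ≠ 0 := by rintro rfl; simp at hc
    have hA' : A ≠ 0 := by rintro rfl; simp at hle; omega
    have h1 : (A * B * C).natDegree = A.natDegree + B.natDegree + C.natDegree := by
      rw [natDegree_mul (mul_ne_zero hA' hB') hC', natDegree_mul hA' hB']
    have h2 : A * B * C = A * E + D * C - F := by rw [← heq]; ring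
    have h3 : (A * E).natDegree ≤ A.natDegree + p := natDegree_mul_le.trans (by omega)
    have h4 : (D * C).natDegree ≤ A.natDegree + p := natDegree_mul_le.trans (by omega)
    have h5 : (A * E + D * C - F).natDegree ≤ A.natDegree + p :=
      (natDegree_sub_le_of_le (natDegree_add_le_of_degree_le h3 h4) (hF.trans (by omega) : F.natDegree ≤ A.natDegree + p)).trans (by simp)
    rw [← h2, h1] at h5
    omega
  refine ⟨(Finset.Icc 1 A.natDegree).image A.coeff ∪ (Finset.Icc 1 B.natDegree).image B.coeff ∪
    (Finset.Icc 1 C.natDegree).image C.coeff ∪ (Finset.Icc 1 p).image D.coeff ∪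
    (Finset.Icc 1 (p - A.natDegree)).image E.coeff, ?_, ?_⟩
  · have i1 := Finset.card_image_le (s := Finset.Icc 1 A.natDegree) (f := A.coeff)
    have i2 := Finset.card_image_le (s := Finset.Icc 1 B.natDegree) (f := B.coeff)
    have i3 := Finset.card_image_le (s := Finset.Icc 1 C.natDegree) (f := C.coeff)
    have i4 := Finset.card_image_le (s := Finset.Icc 1 p) (f := D.coeff)
    have i5 := Finset.card_image_le (s := Finset.Icc 1 (p - A.natDegree)) (f := E.coeff)
    simp only [Nat.card_Icc] at i1 i2 i3 i4 i5
    refine (Finset.card_union_le _ _).trans ?_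
    refine (Nat.add_le_add_right (Finset.card_union_le _ _) _).trans ?_
    refine (Nat.add_le_add_right (Nat.add_le_add_right (Finset.card_union_le _ _) _) _).trans ?_
    refine (Nat.add_le_add_right (Nat.add_le_add_right
      (Nat.add_le_add_right (Finset.card_union_le _ _) _) _) _).trans ?_
    omega
  · intro L hL
    have gen : ∀ (G : K[X]) (m : ℕ), G.natDegree ≤ m → G.coeff 0 = 0 →
        (∀ t ∈ Finset.Icc 1 m, G.coeff t ∈ L) → ∀ t, G.coeff t ∈ L := by
      intro G m hm h0 h t
      rcases Nat.eq_zero_or_pos t with rfl | ht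
      · rw [h0]; exact L.zero_mem
      by_cases htm : t ≤ m
      · exact h t (Finset.mem_Icc.2 ⟨ht, htm⟩)
      · rw [coeff_eq_zero_of_natDegree_lt (by omega)]; exact L.zero_mem
    have mulm : ∀ (G H : K[X]), (∀ t, G.coeff t ∈ L) → (∀ t, H.coeff t ∈ L) →
        ∀ t, (G * H).coeff t ∈ L := by
      intro G H hG hH t
      rw [coeff_mul]
      exact L.sum_mem fun x _ => L.mul_mem (hG _) (hH _)
    have mA := gen A _ le_rfl A0 (fun t ht => hL (by
      simp only [Finset.coe_union, Set.mem_union, Finset.mem_coe]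
      exact .inl <| .inl <| .inl <| .inl <| Finset.mem_image_of_mem _ ht))
    have mB := gen B _ le_rfl B0 (fun t ht => hL (by
      simp only [Finset.coe_union, Set.mem_union, Finset.mem_coe]
      exact .inl <| .inl <| .inl <| .inr <| Finset.mem_image_of_mem _ ht))
    have mC := gen C _ le_rfl C0 (fun t ht => hL (by
      simp only [Finset.coe_union, Set.mem_union, Finset.mem_coe]
      exact .inl <| .inl <| .inr <| Finset.mem_image_of_mem _ ht))
    have mD := gen D _ hD D0 (fun t ht => hL (by
      simp only [Finset.coe_union, Set.mem_union, Finset.mem_coe]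
      exact .inl <| .inr <| Finset.mem_image_of_mem _ ht))
    have mE : ∀ n t, p ≤ t + n → E.coeff t ∈ L := by
      intro n
      induction n using Nat.strong_induction_on with
      | _ n ih =>
      intro t ht
      rcases Nat.eq_zero_or_pos t with rfl | htpos
      · rw [E0]; exact L.zero_mem
      by_cases hta : t ≤ p - A.natDegree
      · apply hL
        simp only [Finset.coe_union, Set.mem_union, Finset.mem_coe]
        exact .inr <| Finset.mem_image_of_mem _ (Finset.mem_Icc.2 ⟨htpos, hta⟩)
      by_cases htp : p < t
      · rw [coeff_eq_zero_of_natDegree_lt (by omega)]; exact L.zero_mem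
      have hapos : 0 < A.natDegree := by omega
      have hA' : A ≠ 0 := by rintro rfl; simp at hapos
      have hl : A.coeff A.natDegree ≠ 0 := by simpa using hA'
      have hc := congrArg (fun q => q.coeff (A.natDegree + t)) heq
      simp only [coeff_add] at hc
      rw [coeff_eq_zero_of_natDegree_lt (p := F) (by omega), zero_add, coeff_mul A E,
        ← Finset.add_sum_erase _ _ (a := (A.natDegree, t)) (by simp)] at hc
      have hs : ∑ x ∈ (Finset.HasAntidiagonal.antidiagonal (A.natDegree + t)).erase (A.natDegree, t),
          A.coeff x.1 * E.coeff x.2 ∈ L := by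
        refine L.sum_mem ?_
        rintro ⟨r, s⟩ hx
        simp only [Finset.mem_erase, Finset.HasAntidiagonal.mem_antidiagonal, ne_eq, Prod.mk.injEq] at hx
        by_cases hr : A.natDegree < r
        · simp only
          rw [coeff_eq_zero_of_natDegree_lt hr, zero_mul]; exact L.zero_mem
        · refine L.mul_mem (mA _) ?_
          by_cases hs : p < s
          · simp only
            rw [coeff_eq_zero_of_natDegree_lt (by omega)]; exact L.zero_mem
          · exact ih (p - s) (by omega) s (by omega)
      have hEt : E.coeff t = ((A * B * C).coeff (A.natDegree + t) -
          ∑ x ∈ (Finset.HasAntidiagonal.antidiagonal (A.natDegree + t)).erase (A.natDegree, t),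
            A.coeff x.1 * E.coeff x.2 - (D * C).coeff (A.natDegree + t)) /
            A.coeff A.natDegree := by
        rw [hc]; field_simp; ring
      rw [hEt]
      exact L.div_mem (L.sub_mem (L.sub_mem (mulm _ _ (mulm _ _ mA mB) mC _) hs)
        (mulm _ _ mD mC _)) (mA _)
    have mE' : ∀ t, E.coeff t ∈ L := fun t => mE p t (by omega)
    intro t
    refine ⟨mA t, mB t, mC t, mD t, mE' t, ?_⟩
    have hc := congrArg (fun q => q.coeff t) heq
    simp only [coeff_add] at hc
    rw [eq_sub_of_add_eq hc]
    exact L.sub_mem (L.add_mem (mulm _ _ mA mE' t) (mulm _ _ mD mC t))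
      (mulm _ _ (mulm _ _ mA mB) mC t)

open Polynomial in
lemma gt_key2 {K : Type*} [Field K] (p : ℕ) (A B C D E F : K[X])
    (hA : A.natDegree ≤ p) (hB : B.natDegree ≤ p) (hC : C.natDegree ≤ p)
    (hD : D.natDegree ≤ p) (hE : E.natDegree ≤ p) (hF : F.natDegree ≤ p)
    (A0 : A.coeff 0 = 0) (B0 : B.coeff 0 = 0) (C0 : C.coeff 0 = 0)
    (D0 : D.coeff 0 = 0) (E0 : E.coeff 0 = 0)
    (heq : F + A * B * C = A * E + D * C) :
    ∃ S : Finset K, S.card ≤ 3 * p ∧ ∀ L : Subfield K, (↑S ⊆ (L : Set K)) →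
      ∀ t, A.coeff t ∈ L ∧ B.coeff t ∈ L ∧ C.coeff t ∈ L ∧ D.coeff t ∈ L ∧ E.coeff t ∈ L ∧
        F.coeff t ∈ L := by
  rcases le_total C.natDegree A.natDegree with h | h
  · exact gt_key p A B C D E F hA hB hC hD hE hF A0 B0 C0 D0 E0 heq h
  · obtain ⟨S, h1, h2⟩ := gt_key p C B A E D F hC hB hA hE hD hF C0 B0 A0 E0 D0
      (by linear_combination heq) h
    refine ⟨S, h1, fun L hL t => ?_⟩
    obtain ⟨a, b, c, d, e, f⟩ := h2 L hL t
    exact ⟨c, b, a, e, d, f⟩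

lemma gt_xvn_out {K : Type*} [CommRing K] (n p : ℕ) (x : Fin n × Fin n × Fin p → K) (a b t : ℕ)
    (h : t = 0 ∨ p < t) : xvn K n p x a b t = 0 := by
  unfold xvn
  rw [dif_neg (by omega)]

/-- generating polynomial of an entry -/
def gtPoly {K : Type*} [CommRing K] (n p : ℕ) (x : Fin n × Fin n × Fin p → K) (a b : ℕ) :
    Polynomial K :=
  ∑ t ∈ Finset.Icc 1 p, Polynomial.monomial t (xvn K n p x a b t)

lemma gtPoly_coeff {K : Type*} [CommRing K] (n p : ℕ) (x : Fin n × Fin n × Fin p → K) (a b t : ℕ) :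
    (gtPoly n p x a b).coeff t = xvn K n p x a b t := by
  unfold gtPoly
  simp only [Polynomial.finsetSum_coeff, Polynomial.coeff_monomial, Finset.sum_ite_eq',
    Finset.mem_Icc]
  split_ifs with h
  · rfl
  · rw [gt_xvn_out]; omega

lemma gtPoly_natDegree {K : Type*} [CommRing K] (n p : ℕ) (x : Fin n × Fin n × Fin p → K)
    (a b : ℕ) : (gtPoly n p x a b).natDegree ≤ p := by
  rw [Polynomial.natDegree_le_iff_coeff_eq_zero]
  intro N hN
  rw [gtPoly_coeff, gt_xvn_out]; omega

lemma gt_sum2 {K : Type*} [CommRing K] (a e : ℕ → K) (i lo hi : ℕ) (hhi : hi ≤ i)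
    (h : ∀ s ≤ i, ¬ (lo ≤ s ∧ s ≤ hi) → a s * e (i - s) = 0) :
    ∑ s ∈ Finset.Icc lo hi, a s * e (i - s) = ∑ s ∈ Finset.range (i + 1), a s * e (i - s) := by
  apply Finset.sum_subset
  · intro s; simp only [Finset.mem_Icc, Finset.mem_range]; omega
  · intro s; simp only [Finset.mem_Icc, Finset.mem_range]
    intro h1 h2; exact h s (by omega) h2

lemma gt_sum3 {K : Type*} [CommRing K] (a b c : ℕ → K) (i lo hi : ℕ) (lo' hi' : ℕ → ℕ)
    (hhi : hi ≤ i) (hhi' : ∀ r, lo ≤ r → r ≤ hi → hi' r ≤ i - r)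
    (h : ∀ r s, r + s ≤ i → ¬ (lo ≤ r ∧ r ≤ hi ∧ lo' r ≤ s ∧ s ≤ hi' r) →
      a r * b s * c (i - r - s) = 0) :
    ∑ r ∈ Finset.Icc lo hi, ∑ s ∈ Finset.Icc (lo' r) (hi' r), a r * b s * c (i - r - s) =
    ∑ r ∈ Finset.range (i + 1), ∑ s ∈ Finset.range (i - r + 1), a r * b s * c (i - r - s) := by
  trans ∑ r ∈ Finset.Icc lo hi, ∑ s ∈ Finset.range (i - r + 1), a r * b s * c (i - r - s)
  · refine Finset.sum_congr rfl fun r hr => ?_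
    rw [Finset.mem_Icc] at hr
    have := hhi' r hr.1 hr.2
    apply Finset.sum_subset
    · intro s; simp only [Finset.mem_Icc, Finset.mem_range]; omega
    · intro s; simp only [Finset.mem_Icc, Finset.mem_range]
      intro h1 h2; exact h r s (by omega) (by omega)
  · apply Finset.sum_subset
    · intro s; simp only [Finset.mem_Icc, Finset.mem_range]; omega
    · intro r; simp only [Finset.mem_Icc, Finset.mem_range]
      intro h1 h2
      refine Finset.sum_eq_zero fun s hs => ?_
      rw [Finset.mem_range] at hs
      exact h r s (by omega) (by omega)

lemma gt_coeff2 {K : Type*} [CommRing K] (A B : Polynomial K) (i : ℕ) :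
    (A * B).coeff i = ∑ s ∈ Finset.range (i + 1), A.coeff s * B.coeff (i - s) := by
  rw [Polynomial.coeff_mul, Finset.Nat.sum_antidiagonal_eq_sum_range_succ
    (fun r s => A.coeff r * B.coeff s)]

lemma gt_coeff3 {K : Type*} [CommRing K] (A B C : Polynomial K) (i : ℕ) :
    (A * B * C).coeff i = ∑ r ∈ Finset.range (i + 1), ∑ s ∈ Finset.range (i - r + 1),
      A.coeff r * B.coeff s * C.coeff (i - r - s) := by
  rw [mul_assoc, gt_coeff2]
  refine Finset.sum_congr rfl fun r _ => ?_
  rw [gt_coeff2, Finset.mul_sum]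
  simp only [mul_assoc]

lemma gt_P3v {K : Type*} [CommRing K] (p : ℕ) (x : Fin 3 × Fin 3 × Fin p → K)
    (hW : WZero K 3 p x) (i : ℕ) (hi : 1 ≤ i) (hi' : i ≤ 3 * p) :
    P3v K 3 p x i = (gtPoly 3 p x 3 3 + gtPoly 3 p x 1 3 * gtPoly 3 p x 2 1 * gtPoly 3 p x 3 2
      - (gtPoly 3 p x 1 3 * gtPoly 3 p x 3 1 + gtPoly 3 p x 2 3 * gtPoly 3 p x 3 2)).coeff i := by
  have h12 : ∀ t, xvn K 3 p x 1 2 t = 0 := by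
    intro t
    by_cases ht : 1 ≤ t ∧ t ≤ p
    · exact (hW t ht.1 ht.2).2.1
    · exact gt_xvn_out _ _ _ _ _ _ (by omega)
  have h22 : ∀ t, xvn K 3 p x 2 2 t = 0 := by
    intro t
    by_cases ht : 1 ≤ t ∧ t ≤ p
    · exact (hW t ht.1 ht.2).2.2
    · exact gt_xvn_out _ _ _ _ _ _ (by omega)
  rw [Polynomial.coeff_sub, Polynomial.coeff_add, Polynomial.coeff_add, gt_coeff3, gt_coeff2,
    gt_coeff2]
  simp only [gtPoly_coeff]
  have hout : ∀ a b t, (t = 0 ∨ p < t) → xvn K 3 p x a b t = 0 :=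
    fun a b t => gt_xvn_out _ _ _ _ _ _
  have z2 : ∀ a b a' b' s t, (s = 0 ∨ p < s ∨ t = 0 ∨ p < t) →
      xvn K 3 p x a b s * xvn K 3 p x a' b' t = 0 := by
    intro a b a' b' s t h
    by_cases h1 : s = 0 ∨ p < s
    · rw [hout a b s h1, zero_mul]
    · rw [hout a' b' t (by omega), mul_zero]
  have z3 : ∀ r s t, (r = 0 ∨ p < r ∨ s = 0 ∨ p < s ∨ t = 0 ∨ p < t) →
      xvn K 3 p x 1 3 r * xvn K 3 p x 2 1 s * xvn K 3 p x 3 2 t = 0 := by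
    intro r s t h
    by_cases h1 : r = 0 ∨ p < r ∨ s = 0 ∨ p < s
    · rw [z2 _ _ _ _ _ _ h1, zero_mul]
    · rw [hout 3 2 t (by omega), mul_zero]
  unfold P3v
  simp only [Tv, h12, h22, mul_zero, zero_mul, Finset.sum_const_zero, sub_zero, neg_zero, zero_add]
  simp only [Finset.sum_add_distrib]
  split_ifs with c1 c2 c3
  · rw [gt_sum2 (xvn K 3 p x 1 3) (xvn K 3 p x 3 1) i 1 (i - 1) (by omega)
        (fun s hs hn => z2 _ _ _ _ _ _ (by omega)),
      gt_sum2 (xvn K 3 p x 2 3) (xvn K 3 p x 3 2) i 1 (i - 1) (by omega)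
        (fun s hs hn => z2 _ _ _ _ _ _ (by omega)),
      gt_sum3 (xvn K 3 p x 1 3) (xvn K 3 p x 2 1) (xvn K 3 p x 3 2) i 1 (i - 2) (fun _ => 1)
        (fun r => i - r - 1) (by omega) (fun r h1 h2 => by omega)
        (fun r s hs hn => z3 _ _ _ (by omega))]
    ring
  · subst c2
    rw [gt_sum2 (xvn K 3 p x 1 3) (xvn K 3 p x 3 1) (p + 1) 1 p (by omega)
        (fun s hs hn => z2 _ _ _ _ _ _ (by omega)),
      gt_sum2 (xvn K 3 p x 2 3) (xvn K 3 p x 3 2) (p + 1) 1 p (by omega)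
        (fun s hs hn => z2 _ _ _ _ _ _ (by omega)),
      gt_sum3 (xvn K 3 p x 1 3) (xvn K 3 p x 2 1) (xvn K 3 p x 3 2) (p + 1) 1 (p - 1) (fun _ => 1)
        (fun r => p - r) (by omega) (fun r h1 h2 => by omega)
        (fun r s hs hn => z3 _ _ _ (by omega)), hout 3 3 (p + 1) (by omega)]
    ring
  · have hsplit : ∑ r ∈ Finset.Icc 1 (i - p - 1), ∑ s ∈ Finset.Icc (i - p - r) p,
          xvn K 3 p x 1 3 r * xvn K 3 p x 2 1 s * xvn K 3 p x 3 2 (i - r - s) +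
        ∑ r ∈ Finset.Icc (i - p) p, ∑ s ∈ Finset.Icc 1 (i - r - 1),
          xvn K 3 p x 1 3 r * xvn K 3 p x 2 1 s * xvn K 3 p x 3 2 (i - r - s) =
        ∑ r ∈ Finset.range (i + 1), ∑ s ∈ Finset.range (i - r + 1),
          xvn K 3 p x 1 3 r * xvn K 3 p x 2 1 s * xvn K 3 p x 3 2 (i - r - s) := by
      rw [← gt_sum3 (xvn K 3 p x 1 3) (xvn K 3 p x 2 1) (xvn K 3 p x 3 2) i 1 p
        (fun r => if r < i - p then i - p - r else 1)
        (fun r => if r < i - p then p else i - r - 1) (by omega)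
        (fun r h1 h2 => by split_ifs <;> omega)
        (fun r s hs hn => z3 _ _ _ (by split_ifs at hn <;> omega))]
      have hu : Finset.Icc 1 p = Finset.Icc 1 (i - p - 1) ∪ Finset.Icc (i - p) p := by
        ext r; simp only [Finset.mem_Icc, Finset.mem_union]; omega
      have hd : Disjoint (Finset.Icc 1 (i - p - 1)) (Finset.Icc (i - p) p) := by
        rw [Finset.disjoint_left]; intro r; simp only [Finset.mem_Icc]; omega
      rw [hu, Finset.sum_union hd]
      congr 1
      · refine Finset.sum_congr rfl fun r hr => ?_
        rw [Finset.mem_Icc] at hr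
        rw [if_pos (by omega), if_pos (by omega)]
      · refine Finset.sum_congr rfl fun r hr => ?_
        rw [Finset.mem_Icc] at hr
        rw [if_neg (by omega), if_neg (by omega)]
    rw [add_assoc, hsplit,
      gt_sum2 (xvn K 3 p x 1 3) (xvn K 3 p x 3 1) i (i - p) p (by omega)
        (fun s hs hn => z2 _ _ _ _ _ _ (by omega)),
      gt_sum2 (xvn K 3 p x 2 3) (xvn K 3 p x 3 2) i (i - p) p (by omega)
        (fun s hs hn => z2 _ _ _ _ _ _ (by omega)), hout 3 3 i (by omega)]
    ring
  · rw [gt_sum3 (xvn K 3 p x 1 3) (xvn K 3 p x 2 1) (xvn K 3 p x 3 2) i (i - 2 * p) p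
        (fun r => i - p - r)
        (fun r => p) (by omega) (fun r h1 h2 => by omega)
        (fun r s hs hn => z3 _ _ _ (by omega)), hout 3 3 i (by omega),
      Finset.sum_eq_zero (s := Finset.range (i + 1))
        (f := fun s => xvn K 3 p x 1 3 s * xvn K 3 p x 3 1 (i - s))
        (fun s hs => z2 _ _ _ _ _ _ (by omega)),
      Finset.sum_eq_zero (s := Finset.range (i + 1))
        (f := fun s => xvn K 3 p x 2 3 s * xvn K 3 p x 3 2 (i - s))
        (fun s hs => z2 _ _ _ _ _ _ (by omega))]
    ring

lemma gt_poly_eq {K : Type*} [CommRing K] (p : ℕ) (x : Fin 3 × Fin 3 × Fin p → K)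
    (hW : WZero K 3 p x) (hP : P3Zero K 3 p x (3 * p)) :
    gtPoly 3 p x 3 3 + gtPoly 3 p x 1 3 * gtPoly 3 p x 2 1 * gtPoly 3 p x 3 2
      = (gtPoly 3 p x 1 3 * gtPoly 3 p x 3 1 + gtPoly 3 p x 2 3 * gtPoly 3 p x 3 2) := by
  rw [← sub_eq_zero]
  ext i
  rw [Polynomial.coeff_zero]
  have hd := gtPoly_natDegree 3 p x
  have h0 : ∀ a b, (gtPoly 3 p x a b).coeff 0 = 0 := fun a b => by
    rw [gtPoly_coeff, gt_xvn_out _ _ _ _ _ _ (.inl rfl)]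
  rcases Nat.eq_zero_or_pos i with rfl | hi
  · simp [Polynomial.mul_coeff_zero, h0]
  by_cases hi' : i ≤ 3 * p
  · rw [← gt_P3v p x hW i hi hi']; exact hP i hi hi'
  · apply Polynomial.coeff_eq_zero_of_natDegree_lt
    refine lt_of_le_of_lt ?_ (not_le.1 hi')
    have m2 : ∀ a b c d, (gtPoly 3 p x a b * gtPoly 3 p x c d).natDegree ≤ 2 * p := by
      intro a b c d
      have := hd a b; have := hd c d
      exact Polynomial.natDegree_mul_le.trans (by omega)
    have m3 : (gtPoly 3 p x 1 3 * gtPoly 3 p x 2 1 * gtPoly 3 p x 3 2).natDegree ≤ 3 * p := by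
      have := m2 1 3 2 1; have := hd 3 2
      exact Polynomial.natDegree_mul_le.trans (by omega)
    have a1 := m2 1 3 3 1
    have a2 := m2 2 3 3 2
    have a3 := hd 3 3
    refine (Polynomial.natDegree_sub_le_of_le (Polynomial.natDegree_add_le_of_degree_le
      (a3.trans (by omega)) m3) (Polynomial.natDegree_add_le_of_degree_le
      (a1.trans (by omega : _ ≤ 3 * p)) (a2.trans (by omega)))).trans (by simp)

lemma gt_key3 {K : Type*} [Field K] (p : ℕ) (x : Fin 3 × Fin 3 × Fin p → K)
    (hW : WZero K 3 p x) (hP : P3Zero K 3 p x (3 * p)) :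
    ∃ S : Finset K, S.card ≤ 3 * p ∧ ∀ L : Subfield K, (↑S ⊆ (L : Set K)) → ∀ i, x i ∈ L := by
  have h0 : ∀ a b, (gtPoly 3 p x a b).coeff 0 = 0 := fun a b => by
    rw [gtPoly_coeff, gt_xvn_out _ _ _ _ _ _ (.inl rfl)]
  have hd := gtPoly_natDegree 3 p x
  obtain ⟨S, h1, h2⟩ := gt_key2 p _ _ _ _ _ _ (hd 1 3) (hd 2 1) (hd 3 2) (hd 2 3) (hd 3 1)
    (hd 3 3) (h0 _ _) (h0 _ _) (h0 _ _) (h0 _ _) (h0 _ _) (gt_poly_eq p x hW hP)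
  refine ⟨S, h1, fun L hL => ?_⟩
  rintro ⟨a, b, t⟩
  have h3 := h2 L hL (t + 1)
  simp only [gtPoly_coeff] at h3
  have hw := hW (t + 1) (by omega) (by omega)
  have hx : x (a, b, t) = xvn K 3 p x (a + 1) (b + 1) (t + 1) := by
    unfold xvn
    rw [dif_pos (by omega)]
    rfl
  rw [hx]
  obtain ⟨i1, i2, i3, i4, i5, i6⟩ := h3
  obtain ⟨j1, j2, j3⟩ := hw
  have hz := L.zero_mem
  rw [← j1] at hz
  have hz2 := L.zero_mem
  rw [← j2] at hz2
  have hz3 := L.zero_mem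
  rw [← j3] at hz3
  fin_cases a <;> fin_cases b <;> assumption

section gttop
variable {k : Type*} [Field k] {σ : Type*}

lemma gt_induced : zariskiTopology k σ =
    TopologicalSpace.induced (MvPolynomial.pointToPoint (k := k) (K := k) (σ := σ))
      PrimeSpectrum.zariskiTopology := by
  rw [PrimeSpectrum.isTopologicalBasis_basic_opens.eq_generateFrom, induced_generateFrom_eq,
    zariskiTopology]
  congr 1
  ext U
  simp only [Set.mem_setOf_eq, Set.mem_image, Set.mem_range, exists_exists_eq_and]
  refine exists_congr fun f => ?_
  have : (MvPolynomial.pointToPoint (k := k) (K := k) (σ := σ)) ⁻¹'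
      (PrimeSpectrum.basicOpen f : Set (PrimeSpectrum (MvPolynomial σ k))) =
      {x | MvPolynomial.eval x f ≠ 0} := by
    ext x
    simp only [Set.mem_preimage, SetLike.mem_coe, PrimeSpectrum.mem_basicOpen,
      Set.mem_setOf_eq, MvPolynomial.pointToPoint, MvPolynomial.mem_vanishingIdeal_singleton_iff,
      MvPolynomial.aeval_eq_eval, ne_eq]
  rw [this]
  exact eq_comm

lemma gt_irred_of_inducing {X Y : Type*} [TopologicalSpace X] [TopologicalSpace Y] {f : Y → X}
    (hf : Topology.IsInducing f) (s : Set Y) : IsIrreducible (f '' s) ↔ IsIrreducible s := by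
  refine ⟨fun h => ⟨Set.image_nonempty.1 h.1, ?_⟩, fun h => h.image f hf.continuous.continuousOn⟩
  intro u v hu hv hsu hsv
  obtain ⟨u', hu', rfl⟩ := hf.isOpen_iff.1 hu
  obtain ⟨v', hv', rfl⟩ := hf.isOpen_iff.1 hv
  obtain ⟨x, hx, hxu⟩ := hsu
  obtain ⟨y, hy, hyv⟩ := hsv
  obtain ⟨z, ⟨w, hw, rfl⟩, hz⟩ := h.2 u' v' hu' hv' ⟨_, ⟨x, hx, rfl⟩, hxu⟩ ⟨_, ⟨y, hy, rfl⟩, hyv⟩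
  exact ⟨w, hw, hz⟩

variable {Y : Type*} [tY : TopologicalSpace Y] (g : Y → σ → k)

lemma gt_inducing (hg : tY = TopologicalSpace.induced g (zariskiTopology k σ)) :
    Topology.IsInducing (fun y => MvPolynomial.pointToPoint (k := k) (K := k) (g y)) := by
  constructor
  rw [hg, gt_induced, induced_compose]
  rfl

lemma gt_irred_iff (hg : tY = TopologicalSpace.induced g (zariskiTopology k σ)) (Z : Set Y) :
    IsIrreducible Z ↔ (MvPolynomial.vanishingIdeal k (g '' Z)).IsPrime := by
  rw [← gt_irred_of_inducing (gt_inducing g hg), PrimeSpectrum.isIrreducible_iff_vanishingIdeal_isPrime,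
    ← MvPolynomial.vanishingIdeal_pointToPoint, Set.image_image]

lemma gt_closed_iff (hg : tY = TopologicalSpace.induced g (zariskiTopology k σ)) (Z : Set Y) :
    IsClosed Z ↔ ∃ J : Ideal (MvPolynomial σ k), Z = g ⁻¹' (MvPolynomial.zeroLocus k J) := by
  rw [(gt_inducing g hg).isClosed_iff]
  have key : ∀ J : Ideal (MvPolynomial σ k), (fun y => MvPolynomial.pointToPoint (k := k) (K := k) (g y)) ⁻¹'
      (PrimeSpectrum.zeroLocus (J : Set (MvPolynomial σ k))) = g ⁻¹' (MvPolynomial.zeroLocus k J) := by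
    intro J
    ext y
    simp only [Set.mem_preimage, PrimeSpectrum.mem_zeroLocus, MvPolynomial.mem_zeroLocus_iff,
      MvPolynomial.pointToPoint, SetLike.coe_subset_coe]
    constructor
    · intro h q hq
      exact (MvPolynomial.mem_vanishingIdeal_singleton_iff _ _).1 (h hq)
    · intro h q hq
      exact (MvPolynomial.mem_vanishingIdeal_singleton_iff _ _).2 (h q hq)
  constructor
  · rintro ⟨T, hT, rfl⟩
    obtain ⟨J, rfl⟩ := (PrimeSpectrum.isClosed_iff_zeroLocus_ideal _).1 hT
    exact ⟨J, key J⟩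
  · rintro ⟨J, rfl⟩
    exact ⟨_, PrimeSpectrum.isClosed_zeroLocus _, key J⟩

lemma gt_dim [IsAlgClosed k] [Finite σ]
    (hg : tY = TopologicalSpace.induced g (zariskiTopology k σ))
    (P : Ideal (MvPolynomial σ k)) (hr : Set.range g = MvPolynomial.zeroLocus k P) (hP : P.IsPrime) :
    topologicalKrullDim Y = ringKrullDim (MvPolynomial σ k ⧸ P) := by
  rw [ringKrullDim_quotient, topologicalKrullDim]
  apply le_antisymm
  · rw [← Order.krullDim_orderDual (α := PrimeSpectrum.zeroLocus _)]
    let f : TopologicalSpace.IrreducibleCloseds Y →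
        (PrimeSpectrum.zeroLocus (P : Set (MvPolynomial σ k)))ᵒᵈ := fun Z =>
      OrderDual.toDual ⟨⟨_, (gt_irred_iff g hg Z).1 Z.isIrreducible⟩, by
        rw [PrimeSpectrum.mem_zeroLocus]
        have : g '' Z ⊆ MvPolynomial.zeroLocus k P := hr ▸ Set.image_subset_range _ _
        exact MvPolynomial.le_zeroLocus_iff_le_vanishingIdeal.1 this⟩
    apply Order.krullDim_le_of_strictMono f
    intro Z Z' hZ
    have hle : (Z : Set Y) ⊆ Z' := hZ.le
    have h1 : MvPolynomial.vanishingIdeal k (g '' Z') ≤ MvPolynomial.vanishingIdeal k (g '' Z) :=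
      MvPolynomial.vanishingIdeal_anti_mono (Set.image_mono hle)
    refine lt_of_le_not_ge h1 fun h2 => hZ.not_ge ?_
    replace h2 : MvPolynomial.vanishingIdeal k (g '' Z) ≤ MvPolynomial.vanishingIdeal k (g '' Z') := h2
    obtain ⟨J, hJ⟩ := (gt_closed_iff g hg Z).1 Z.isClosed
    have h3 : J ≤ MvPolynomial.vanishingIdeal k (g '' Z) := by
      rw [← MvPolynomial.le_zeroLocus_iff_le_vanishingIdeal (K := k), hJ]
      exact Set.image_preimage_subset _ _
    have h4 := MvPolynomial.le_zeroLocus_iff_le_vanishingIdeal.2 (h3.trans h2)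
    intro y hy
    show y ∈ (Z : Set Y)
    rw [hJ]
    exact h4 ⟨y, hy, rfl⟩
  · rw [← Order.krullDim_orderDual (α := PrimeSpectrum.zeroLocus _)]
    have him : ∀ Q : Ideal (MvPolynomial σ k), P ≤ Q →
        g '' (g ⁻¹' (MvPolynomial.zeroLocus k Q)) = MvPolynomial.zeroLocus k Q := by
      intro Q hQ
      rw [Set.image_preimage_eq_iff, hr]
      exact MvPolynomial.zeroLocus_anti_mono hQ
    let f : (PrimeSpectrum.zeroLocus (P : Set (MvPolynomial σ k)))ᵒᵈ →
        TopologicalSpace.IrreducibleCloseds Y := fun Q =>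
      ⟨g ⁻¹' (MvPolynomial.zeroLocus k (OrderDual.ofDual Q).1.asIdeal), by
        rw [gt_irred_iff g hg, him _ (OrderDual.ofDual Q).2]
        have := (OrderDual.ofDual Q).1.isPrime
        rwa [MvPolynomial.IsPrime.vanishingIdeal_zeroLocus], by
        rw [gt_closed_iff g hg]
        exact ⟨_, rfl⟩⟩
    apply Order.krullDim_le_of_strictMono f
    intro Q Q' hQ
    have hle : (OrderDual.ofDual Q').1.asIdeal ≤ (OrderDual.ofDual Q).1.asIdeal := hQ.le
    have h1 : g ⁻¹' (MvPolynomial.zeroLocus k (OrderDual.ofDual Q).1.asIdeal) ⊆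
      g ⁻¹' (MvPolynomial.zeroLocus k (OrderDual.ofDual Q').1.asIdeal) :=
      Set.preimage_mono (MvPolynomial.zeroLocus_anti_mono hle)
    refine lt_of_le_not_ge h1 fun h2 => hQ.not_ge ?_
    replace h2 : g ⁻¹' (MvPolynomial.zeroLocus k (OrderDual.ofDual Q').1.asIdeal) ⊆
      g ⁻¹' (MvPolynomial.zeroLocus k (OrderDual.ofDual Q).1.asIdeal) := h2
    have h3 := Set.image_mono (f := g) h2
    rw [him _ (OrderDual.ofDual Q).2, him _ (OrderDual.ofDual Q').2] at h3
    have h4 := MvPolynomial.vanishingIdeal_anti_mono (k := k) h3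
    have := (OrderDual.ofDual Q).1.isPrime
    have := (OrderDual.ofDual Q').1.isPrime
    rw [MvPolynomial.IsPrime.vanishingIdeal_zeroLocus,
      MvPolynomial.IsPrime.vanishingIdeal_zeroLocus] at h4
    exact h4

/-- reduction of a component to a minimal prime -/
lemma gt_component [IsAlgClosed k] [Finite σ] (I : Ideal (MvPolynomial σ k)) (V : Set (σ → k))
    (hV : V = MvPolynomial.zeroLocus k I) (C : Set V) (hC : C ∈ zComponents k σ V) :
    ∃ P ∈ I.minimalPrimes, zKrullDimSub k σ C = ringKrullDim (MvPolynomial σ k ⧸ P) := by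
  letI tV : TopologicalSpace V := TopologicalSpace.induced Subtype.val (zariskiTopology k σ)
  have hC' : C ∈ irreducibleComponents V := hC
  let g : V → σ → k := Subtype.val
  have hg : tV = TopologicalSpace.induced g (zariskiTopology k σ) := rfl
  have hCirr : IsIrreducible C := hC'.1
  have hCcl : IsClosed C := isClosed_of_mem_irreducibleComponents C hC'
  have hP := (gt_irred_iff g hg C).1 hCirr
  have hrg : Set.range g = MvPolynomial.zeroLocus k I := by rw [← hV]; exact Subtype.range_val
  have him : ∀ Q : Ideal (MvPolynomial σ k), I ≤ Q →
      g '' (g ⁻¹' (MvPolynomial.zeroLocus k Q)) = MvPolynomial.zeroLocus k Q := by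
    intro Q hQ
    rw [Set.image_preimage_eq_iff, hrg]
    exact MvPolynomial.zeroLocus_anti_mono hQ
  have hIP : I ≤ MvPolynomial.vanishingIdeal k (g '' C) := by
    rw [← MvPolynomial.le_zeroLocus_iff_le_vanishingIdeal (K := k), ← hrg]
    exact Set.image_subset_range _ _
  have hmax : ∀ Q : Ideal (MvPolynomial σ k), Q.IsPrime → I ≤ Q →
      Q ≤ MvPolynomial.vanishingIdeal k (g '' C) → MvPolynomial.zeroLocus k Q ⊆ g '' C := by
    intro Q hQ hIQ hQP
    have h1 : IsIrreducible (g ⁻¹' (MvPolynomial.zeroLocus k Q)) := by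
      rw [gt_irred_iff g hg, him Q hIQ]
      rwa [MvPolynomial.IsPrime.vanishingIdeal_zeroLocus]
    have h2 : C ⊆ g ⁻¹' (MvPolynomial.zeroLocus k Q) := by
      rw [← Set.image_subset_iff]
      exact MvPolynomial.le_zeroLocus_iff_le_vanishingIdeal.2 hQP
    have h3 := hC'.2 h1 h2
    rw [← him Q hIQ]
    exact Set.image_mono h3
  refine ⟨MvPolynomial.vanishingIdeal k (g '' C), ⟨⟨hP, hIP⟩, ?_⟩, ?_⟩
  · rintro Q ⟨hQ, hIQ⟩ hQP
    have := MvPolynomial.vanishingIdeal_anti_mono (k := k) (hmax Q hQ hIQ hQP)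
    rwa [MvPolynomial.IsPrime.vanishingIdeal_zeroLocus] at this
  · letI tC : TopologicalSpace C := TopologicalSpace.induced Subtype.val tV
    show topologicalKrullDim C = _
    refine gt_dim (fun y : C => g y.1) ?_ _ ?_ hP
    · show TopologicalSpace.induced Subtype.val (TopologicalSpace.induced Subtype.val (zariskiTopology k σ)) = _
      rw [induced_compose]; rfl
    · have : Set.range (fun y : C => g y.1) = g '' C := by
        ext z; simp
      rw [this]
      apply le_antisymm
      · exact MvPolynomial.zeroLocus_vanishingIdeal_le _
      · exact hmax _ hP hIP le_rfl

end gttop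

section gtalg
variable {k : Type*} [Field k] {σ : Type*}

/-- translation automorphism -/
def gtTrans (v : σ → k) : MvPolynomial σ k ≃ₐ[k] MvPolynomial σ k :=
  AlgEquiv.ofAlgHom (MvPolynomial.aeval fun i => MvPolynomial.X i + MvPolynomial.C (v i))
    (MvPolynomial.aeval fun i => MvPolynomial.X i - MvPolynomial.C (v i))
    (by ext i; simp [MvPolynomial.algHom_C, ← MvPolynomial.algebraMap_eq])
    (by ext i; simp [MvPolynomial.algHom_C, ← MvPolynomial.algebraMap_eq])

lemma gt_height_max [IsAlgClosed k] [Finite σ] (M : Ideal (MvPolynomial σ k)) (hM : M.IsMaximal) :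
    (M.height : WithBot ℕ∞) = (Nat.card σ : WithBot ℕ∞) := by
  have hall : ∀ M' : Ideal (MvPolynomial σ k), M'.IsMaximal → M'.height = M.height := by
    intro M' hM'
    obtain ⟨x, rfl⟩ := MvPolynomial.isMaximal_iff_eq_vanishingIdeal_singleton.1 hM
    obtain ⟨y, rfl⟩ := MvPolynomial.isMaximal_iff_eq_vanishingIdeal_singleton.1 hM'
    have : MvPolynomial.vanishingIdeal k {y} = (MvPolynomial.vanishingIdeal k {x}).comap
        (gtTrans (fun i => y i - x i)).toRingEquiv := by
      ext f
      rw [Ideal.mem_comap, MvPolynomial.mem_vanishingIdeal_singleton_iff,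
        MvPolynomial.mem_vanishingIdeal_singleton_iff]
      have : MvPolynomial.aeval (R := k) y = (MvPolynomial.aeval (R := k) x).comp
          (gtTrans (fun i => y i - x i)).toAlgHom := by
        ext i; simp [gtTrans]
      rw [this]
      rfl
    rw [this]
    exact RingEquiv.height_comap _ _
  have h1 := Ideal.sup_isMaximal_height_eq_ringKrullDim (R := MvPolynomial σ k)
  rw [MvPolynomial.ringKrullDim_of_isNoetherianRing, ringKrullDim_eq_zero_of_field, zero_add] at h1
  rw [← h1]
  congr 1
  apply le_antisymm
  · exact le_iSup₂_of_le M hM le_rfl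
  · exact iSup₂_le fun M' hM' => (hall M' hM').le

lemma gt_lower [IsAlgClosed k] [Finite σ] (s : Finset (MvPolynomial σ k))
    (P : Ideal (MvPolynomial σ k)) (hP : P ∈ (Ideal.span (s : Set (MvPolynomial σ k))).minimalPrimes) :
    (Nat.card σ : WithBot ℕ∞) ≤ ringKrullDim (MvPolynomial σ k ⧸ P) + s.card := by
  set I := Ideal.span (s : Set (MvPolynomial σ k)) with hI
  have hPp : P.IsPrime := hP.1.1
  have hfin : I.minimalPrimes.Finite := Ideal.finite_minimalPrimes_of_isNoetherianRing _ I
  -- an element in all other minimal primes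
  obtain ⟨f, hfP, hf⟩ : ∃ f, f ∉ P ∧ ∀ Q ∈ I.minimalPrimes, Q ≠ P → f ∈ Q := by
    have h1 : ∀ Q ∈ I.minimalPrimes \ {P}, ∃ f, f ∈ Q ∧ f ∉ P := by
      rintro Q ⟨hQ, hQP⟩
      by_contra! hcon
      exact hQP (le_antisymm hcon (hP.2 hQ.1 hcon))
    choose! F hF1 hF2 using h1
    have hfin' : (I.minimalPrimes \ {P}).Finite := hfin.subset Set.diff_subset
    refine ⟨∏ Q ∈ hfin'.toFinset, F Q, ?_, ?_⟩
    · rw [hPp.prod_mem_iff]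
      rintro ⟨Q, hQ, hQF⟩
      exact hF2 Q (by simpa using hQ) hQF
    · intro Q hQ hQP
      have hm : Q ∈ hfin'.toFinset := by simpa using ⟨hQ, hQP⟩
      exact Ideal.mem_of_dvd _ (Finset.dvd_prod_of_mem F hm) (hF1 Q ⟨hQ, hQP⟩)
  obtain ⟨x, hx, hfx⟩ : ∃ x ∈ MvPolynomial.zeroLocus k P, MvPolynomial.aeval x f ≠ 0 := by
    by_contra! hcon
    apply hfP
    rw [← MvPolynomial.IsPrime.vanishingIdeal_zeroLocus (K := k) P]
    exact hcon
  let M := MvPolynomial.vanishingIdeal k ({x} : Set (σ → k))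
  have hM : M.IsMaximal := MvPolynomial.isMaximal_iff_eq_vanishingIdeal_singleton.2 ⟨x, rfl⟩
  have hPM : P ≤ M := by
    intro q hq
    exact (MvPolynomial.mem_vanishingIdeal_singleton_iff _ _).2 (hx q hq)
  have hfM : f ∉ M := fun h => hfx ((MvPolynomial.mem_vanishingIdeal_singleton_iff _ _).1 h)
  have hIM : I ≤ M := hP.1.2.trans hPM
  have h1 := Ideal.height_le_height_add_encard_of_subset (s : Set (MvPolynomial σ k)) (p := M)
    (Ideal.subset_span.trans hIM)
  rw [← gt_height_max M hM]
  have hMp : (M.map (Ideal.Quotient.mk I)).IsPrime := Ideal.isPrime_map_quotientMk_of_isPrime hIM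
  have h2 : ((M.map (Ideal.Quotient.mk I)).height : WithBot ℕ∞) ≤
      ringKrullDim (MvPolynomial σ k ⧸ P) := by
    have := PrimeSpectrum.height_eq_orderHeight ⟨M.map (Ideal.Quotient.mk I), hMp⟩
    simp only at this
    rw [this, Order.height_eq_krullDim_Iic, ringKrullDim_quotient]
    have hsurj : Function.Surjective (Ideal.Quotient.mk I) := Ideal.Quotient.mk_surjective
    have hmem : ∀ Q : PrimeSpectrum (MvPolynomial σ k ⧸ I),
        Q ≤ ⟨M.map (Ideal.Quotient.mk I), hMp⟩ → P ≤ Q.asIdeal.comap (Ideal.Quotient.mk I) := by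
      intro Q hQ
      have hIQ : I ≤ Q.asIdeal.comap (Ideal.Quotient.mk I) := by
        intro q hq
        rw [Ideal.mem_comap, Ideal.Quotient.eq_zero_iff_mem.2 hq]
        exact Q.asIdeal.zero_mem
      have hQM : Q.asIdeal.comap (Ideal.Quotient.mk I) ≤ M := by
        have hQ' : Q.asIdeal ≤ M.map (Ideal.Quotient.mk I) := hQ
        refine (Ideal.comap_mono hQ').trans ?_
        rw [Ideal.comap_map_of_surjective _ hsurj, sup_le_iff]
        refine ⟨le_rfl, ?_⟩
        rw [← RingHom.ker_eq_comap_bot, Ideal.mk_ker]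
        exact hIM
      obtain ⟨Q', hQ', hle⟩ := Ideal.exists_minimalPrimes_le hIQ
      by_cases h : Q' = P
      · exact h ▸ hle
      · exact absurd (hQM (hle (hf Q' hQ' h))) hfM
    let φ : Set.Iic (⟨M.map (Ideal.Quotient.mk I), hMp⟩ : PrimeSpectrum (MvPolynomial σ k ⧸ I)) →
        PrimeSpectrum.zeroLocus (P : Set (MvPolynomial σ k)) := fun Q =>
      ⟨⟨Q.1.asIdeal.comap (Ideal.Quotient.mk I), inferInstance⟩, hmem Q.1 Q.2⟩
    apply Order.krullDim_le_of_strictMono φ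
    intro Q Q' hQ
    refine lt_of_le_not_ge (Ideal.comap_mono hQ.le :
      Q.1.asIdeal.comap (Ideal.Quotient.mk I) ≤ Q'.1.asIdeal.comap _) fun h => hQ.not_ge ?_
    exact (Ideal.comap_le_comap_iff_of_surjective _ hsurj _ _).1 h
  have h3 : (M.height : WithBot ℕ∞) ≤ ((M.map (Ideal.Quotient.mk I)).height + (s.card : ℕ∞) : ℕ∞) := by
    rw [Set.encard_coe_eq_coe_finsetCard] at h1
    exact_mod_cast h1
  refine h3.trans ?_
  push_cast
  gcongr

lemma gt_upper0 {A : Type*} [CommRing A] [IsDomain A] [Algebra k A] [Algebra.FiniteType k A]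
    {K : Type*} [Field K] [Algebra A K] [IsFractionRing A K] [Algebra k K] [IsScalarTower k A K]
    (φ : MvPolynomial σ k →ₐ[k] A) (hφ : Function.Surjective φ)
    (S : Finset K)
    (hS : ∀ L : Subfield K, ((S : Set K) ⊆ (L : Set K)) →
      ∀ i, algebraMap A K (φ (MvPolynomial.X i)) ∈ L) :
    ringKrullDim A ≤ (S.card : WithBot ℕ∞) := by
  have htop : ∀ z : K, z ∈ IntermediateField.adjoin k (S : Set K) := by
    have h1 := hS (IntermediateField.adjoin k (S : Set K)).toSubfield
      (IntermediateField.subset_adjoin k _)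
    have h2 : ∀ q : MvPolynomial σ k, algebraMap A K (φ q) ∈
        IntermediateField.adjoin k (S : Set K) := by
      intro q
      induction q using MvPolynomial.induction_on with
      | C a =>
        have : algebraMap A K (φ (MvPolynomial.C a)) = algebraMap k K a := by
          rw [IsScalarTower.algebraMap_apply k A K, ← MvPolynomial.algebraMap_eq, AlgHom.commutes]
        rw [this]
        exact IntermediateField.algebraMap_mem _ a
      | add p q hp hq => rw [map_add, map_add]; exact add_mem hp hq
      | mul_X p i hp => rw [map_mul, map_mul]; exact mul_mem hp (h1 i)
    intro z
    obtain ⟨a, b, hb, rfl⟩ := IsFractionRing.div_surjective (A := A) z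
    obtain ⟨a, rfl⟩ := hφ a
    obtain ⟨b, rfl⟩ := hφ b
    exact div_mem (h2 a) (h2 b)
  have halg : Algebra.IsAlgebraic (Algebra.adjoin k (S : Set K)) K := by
    constructor
    intro z
    obtain ⟨r, hr, s, hs, rfl⟩ := IntermediateField.mem_adjoin_iff_div.1 (htop z)
    have ha : IsAlgebraic (Algebra.adjoin k (S : Set K)) r :=
      isAlgebraic_algebraMap (⟨r, hr⟩ : Algebra.adjoin k (S : Set K))
    have hb : IsAlgebraic (Algebra.adjoin k (S : Set K)) s :=
      isAlgebraic_algebraMap (⟨s, hs⟩ : Algebra.adjoin k (S : Set K))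
    rw [div_eq_mul_inv]
    exact ha.mul hb.inv
  obtain ⟨u, hu, hub⟩ := exists_isTranscendenceBasis_subset (R := k) (S : Set K)
  have htr : Algebra.trdeg k K ≤ S.card := by
    rw [← hub.cardinalMk_eq_trdeg]
    refine (Cardinal.mk_le_mk_of_subset hu).trans ?_
    simp
  obtain ⟨s, g, hinj, hint⟩ := exists_integral_inj_algHom_of_fg k A
  have hs : s ≤ S.card := by
    have hinj' : Function.Injective ((IsScalarTower.toAlgHom k A K).comp g) := by
      rw [AlgHom.coe_comp]
      exact (IsFractionRing.injective A K).comp hinj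
    have h1 : AlgebraicIndependent k (fun i : Fin s =>
        ((IsScalarTower.toAlgHom k A K).comp g) (MvPolynomial.X i)) := by
      rw [AlgebraicIndependent]
      convert hinj' using 2
      ext i; simp
    have h2 := h1.lift_cardinalMk_le_trdeg
    have h3 := (Cardinal.lift_le.2 htr)
    have h4 := h2.trans h3
    simpa using h4
  have hdim : ringKrullDim A ≤ ringKrullDim (MvPolynomial (Fin s) k) := by
    apply Order.krullDim_le_of_strictMono (PrimeSpectrum.comap (g : MvPolynomial (Fin s) k →+* A))
    intro Q Q' hQ
    letI := (g : MvPolynomial (Fin s) k →+* A).toAlgebra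
    haveI : Algebra.IsIntegral (MvPolynomial (Fin s) k) A := ⟨hint⟩
    exact Ideal.IsIntegral.comap_lt_comap (R := MvPolynomial (Fin s) k) (I := Q.asIdeal) (J := Q'.asIdeal) hQ
  rw [MvPolynomial.ringKrullDim_of_isNoetherianRing, ringKrullDim_eq_zero_of_field, zero_add] at hdim
  refine hdim.trans ?_
  simpa using hs

lemma gt_upper [Finite σ] (P : Ideal (MvPolynomial σ k)) [hP : P.IsPrime]
    (S : Finset (FractionRing (MvPolynomial σ k ⧸ P)))
    (hS : ∀ L : Subfield (FractionRing (MvPolynomial σ k ⧸ P)),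
      ((S : Set (FractionRing (MvPolynomial σ k ⧸ P))) ⊆
        (L : Set (FractionRing (MvPolynomial σ k ⧸ P)))) →
      ∀ i, algebraMap _ (FractionRing (MvPolynomial σ k ⧸ P))
        (Ideal.Quotient.mk P (MvPolynomial.X i)) ∈ L) :
    ringKrullDim (MvPolynomial σ k ⧸ P) ≤ (S.card : WithBot ℕ∞) :=
  gt_upper0 (Ideal.Quotient.mkₐ k P) (Ideal.Quotient.mkₐ_surjective k P) S hS

end gtalg


lemma gt_xvn_map {R R' : Type*} [CommRing R] [CommRing R'] (φ : R →+* R') (n p : ℕ)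
    (x : Fin n × Fin n × Fin p → R) (a b t : ℕ) :
    φ (xvn R n p x a b t) = xvn R' n p (fun i => φ (x i)) a b t := by
  unfold xvn
  split_ifs <;> simp

lemma gt_P3v_map {R R' : Type*} [CommRing R] [CommRing R'] (φ : R →+* R') (n p : ℕ)
    (x : Fin n × Fin n × Fin p → R) (j : ℕ) :
    φ (P3v R n p x j) = P3v R' n p (fun i => φ (x i)) j := by
  unfold P3v Tv
  split_ifs <;> simp only [map_add, map_sub, map_neg, map_mul, map_sum, gt_xvn_map]

/-- the generators of the ideal -/
def gtGens (k : Type*) [Field k] (p : ℕ) : Finset (MvPolynomial (Fin 3 × Fin 3 × Fin p) k) :=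
  (Finset.Icc 1 p).image (fun t => xvn _ 3 p MvPolynomial.X 1 1 t) ∪
  (Finset.Icc 1 p).image (fun t => xvn _ 3 p MvPolynomial.X 1 2 t) ∪
  (Finset.Icc 1 p).image (fun t => xvn _ 3 p MvPolynomial.X 2 2 t) ∪
  (Finset.Icc 1 (3 * p)).image (fun j => P3v _ 3 p MvPolynomial.X j)

lemma gtGens_card (k : Type*) [Field k] (p : ℕ) : (gtGens k p).card ≤ 6 * p := by
  unfold gtGens
  refine (Finset.card_union_le _ _).trans ?_
  have h1 := Finset.card_union_le ((Finset.Icc 1 p).image (fun t => xvn (MvPolynomial (Fin 3 × Fin 3 × Fin p) k) 3 p MvPolynomial.X 1 1 t) ∪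
    (Finset.Icc 1 p).image (fun t => xvn _ 3 p MvPolynomial.X 1 2 t))
    ((Finset.Icc 1 p).image (fun t => xvn _ 3 p MvPolynomial.X 2 2 t))
  have h2 := Finset.card_union_le ((Finset.Icc 1 p).image (fun t => xvn (MvPolynomial (Fin 3 × Fin 3 × Fin p) k) 3 p MvPolynomial.X 1 1 t))
    ((Finset.Icc 1 p).image (fun t => xvn _ 3 p MvPolynomial.X 1 2 t))
  have a1 := Finset.card_image_le (s := Finset.Icc 1 p) (f := fun t => xvn (MvPolynomial (Fin 3 × Fin 3 × Fin p) k) 3 p MvPolynomial.X 1 1 t)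
  have a2 := Finset.card_image_le (s := Finset.Icc 1 p) (f := fun t => xvn (MvPolynomial (Fin 3 × Fin 3 × Fin p) k) 3 p MvPolynomial.X 1 2 t)
  have a3 := Finset.card_image_le (s := Finset.Icc 1 p) (f := fun t => xvn (MvPolynomial (Fin 3 × Fin 3 × Fin p) k) 3 p MvPolynomial.X 2 2 t)
  have a4 := Finset.card_image_le (s := Finset.Icc 1 (3 * p)) (f := fun t => P3v (MvPolynomial (Fin 3 × Fin 3 × Fin p) k) 3 p MvPolynomial.X t)
  simp only [Nat.card_Icc, Nat.add_sub_cancel] at a1 a2 a3 a4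
  omega

lemma gtGens_zero {k : Type*} [Field k] {p : ℕ} {R : Type*} [CommRing R]
    (φ : MvPolynomial (Fin 3 × Fin 3 × Fin p) k →+* R) :
    (∀ g ∈ gtGens k p, φ g = 0) ↔ WZero R 3 p (fun i => φ (MvPolynomial.X i)) ∧
      P3Zero R 3 p (fun i => φ (MvPolynomial.X i)) (3 * p) := by
  unfold WZero P3Zero gtGens
  simp only [← gt_xvn_map, ← gt_P3v_map, Finset.mem_union, Finset.mem_image, Finset.mem_Icc]
  constructor
  · intro h
    refine ⟨fun t h1 h2 => ⟨h _ (.inl (.inl (.inl ⟨t, ⟨h1, h2⟩, rfl⟩))),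
      h _ (.inl (.inl (.inr ⟨t, ⟨h1, h2⟩, rfl⟩))), h _ (.inl (.inr ⟨t, ⟨h1, h2⟩, rfl⟩))⟩,
      fun j h1 h2 => h _ (.inr ⟨j, ⟨h1, h2⟩, rfl⟩)⟩
  · rintro ⟨h1, h2⟩ g (((⟨t, ht, rfl⟩ | ⟨t, ht, rfl⟩) | ⟨t, ht, rfl⟩) | ⟨t, ht, rfl⟩)
    · exact (h1 t ht.1 ht.2).1
    · exact (h1 t ht.1 ht.2).2.1
    · exact (h1 t ht.1 ht.2).2.2
    · exact h2 t ht.1 ht.2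

lemma gt_GTs1_eq (k : Type*) [Field k] (p : ℕ) :
    GTs1 k 3 p = MvPolynomial.zeroLocus k
      (Ideal.span (gtGens k p : Set (MvPolynomial (Fin 3 × Fin 3 × Fin p) k))) := by
  rw [MvPolynomial.zeroLocus_span]
  ext x
  have := gtGens_zero (k := k) (p := p)
    (MvPolynomial.aeval x : MvPolynomial (Fin 3 × Fin 3 × Fin p) k →ₐ[k] k).toRingHom
  simp only [AlgHom.toRingHom_eq_coe, RingHom.coe_coe, MvPolynomial.aeval_X] at this
  simp only [GTs1, Set.mem_setOf_eq, Finset.mem_coe]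
  rw [this]
  refine ⟨fun h => ⟨h.1, h.2.1⟩, fun h => ⟨h.1, h.2, ?_⟩⟩
  intro m j h1 h2
  omega

/-- For every `p ≥ 1`, the weak version `GTs₁` of the Gelfand–Tsetlin variety for the
restricted Yangian `Y_p(gl_3)` is equidimensional of dimension `3p`. -/
theorem GTs1_equidim (k : Type*) [Field k] [IsAlgClosed k] [CharZero k]
    (p : ℕ) (hp : 1 ≤ p) :
    IsEquidimOfDim k (Fin 3 × Fin 3 × Fin p) (GTs1 k 3 p) (3 * p) := by
  intro C hC
  obtain ⟨P, hP, hdim⟩ := gt_component _ _ (gt_GTs1_eq k p) C hC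
  rw [hdim]
  have hPp : P.IsPrime := hP.1.1
  have hlow := gt_lower (gtGens k p) P hP
  have hz := (gtGens_zero ((algebraMap (MvPolynomial (Fin 3 × Fin 3 × Fin p) k ⧸ P)
    (FractionRing (MvPolynomial (Fin 3 × Fin 3 × Fin p) k ⧸ P))).comp
      (Ideal.Quotient.mk P))).1 (by
      intro g hg
      rw [RingHom.comp_apply, Ideal.Quotient.eq_zero_iff_mem.2 (hP.1.2 (Ideal.subset_span hg)),
        map_zero])
  obtain ⟨S, hS, hgen⟩ := gt_key3 p _ hz.1 hz.2
  have hup := gt_upper P S hgen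
  have hcard := gtGens_card k p
  have hN : Nat.card (Fin 3 × Fin 3 × Fin p) = 9 * p := by
    simp; ring
  rw [hN] at hlow
  have hne : Nontrivial (MvPolynomial (Fin 3 × Fin 3 × Fin p) k ⧸ P) := inferInstance
  have h0 := ringKrullDim_nonneg_of_nontrivial (R := MvPolynomial (Fin 3 × Fin 3 × Fin p) k ⧸ P)
  generalize ringKrullDim (MvPolynomial (Fin 3 × Fin 3 × Fin p) k ⧸ P) = d at *
  have : ∃ m : ℕ, d = (m : WithBot ℕ∞) := by
    induction d using WithBot.recBotCoe with
    | bot => simp at h0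
    | coe e =>
      induction e using ENat.recTopCoe with
      | top =>
        exfalso
        have h2 : ((⊤ : ℕ∞) : WithBot ℕ∞) ≤ ((S.card : ℕ∞) : WithBot ℕ∞) := hup
        rw [WithBot.coe_le_coe] at h2
        simp at h2
      | coe m => exact ⟨m, rfl⟩
  obtain ⟨m, rfl⟩ := this
  have h1 : 9 * p ≤ m + (gtGens k p).card := by exact_mod_cast hlow
  have h2 : m ≤ S.card := by exact_mod_cast hup
  have : m = 3 * p := by omega
  rw [this]

end
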